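/- arXiv:1611.00258 — 10 statements merged into one kernel-verified Lean document; each statement's English description precedes it below -/
import Mathlib

section
/- In the random lattice path model of length n, the expected number of zeros satisfies E[Z_n] = H^odd_{n+1}, i.e. (1/(n+1)) Σ_{ℓ=0}^{n} (1/C(n,ℓ)) Σ_{w∈P(n,ℓ)} Z(w) = Σ_{m=1}^{n+1} [m odd]/m. -/
/-- The step value of a lattice path: `true` is an up-step (+1), `false` a down-step (−1). -/
def pathStep (b : Bool) : ℤ := if b then 1 else -1

/-- Partial sum `s_t(w) = Σ_{i<t} w(i)` of a lattice path of length `n`. -/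
def psum {n : ℕ} (w : Fin n → Bool) (t : ℕ) : ℤ :=
  ∑ i ∈ Finset.univ.filter (fun i : Fin n => (i : ℕ) < t), pathStep (w i)

/-- `P(n,ℓ)`: lattice paths of length `n` with exactly `ℓ` down-steps. -/
def paths (n ℓ : ℕ) : Finset (Fin n → Bool) :=
  Finset.univ.filter (fun w => (Finset.univ.filter (fun i => w i = false)).card = ℓ)

/-- `Z(w)`: the number of zeros of the lattice path `w`, i.e. indices `t ∈ {0,…,n}`
with `s_t(w) = 0`. -/
def numZeros {n : ℕ} (w : Fin n → Bool) : ℕ :=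
  ((Finset.range (n + 1)).filter (fun t => psum w t = 0)).card

/-- The number of down-steps of a lattice path. -/
def downSteps {n : ℕ} (w : Fin n → Bool) : ℕ :=
  (Finset.univ.filter (fun i => w i = false)).card

/-- The probability of a path in the random lattice path model. -/
noncomputable def pathProb {n : ℕ} (w : Fin n → Bool) : ℝ :=
  1 / ((n : ℝ) + 1) * (1 / (n.choose (downSteps w) : ℝ))

theorem downSteps_le {n : ℕ} (w : Fin n → Bool) : downSteps w ≤ n := by
  simpa [downSteps] using Finset.card_filter_le (Finset.univ : Finset (Fin n)) (fun i => w i = false)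

theorem downSteps_snoc {n : ℕ} (w : Fin n → Bool) (b : Bool) :
    downSteps (Fin.snoc w b : Fin (n + 1) → Bool) = downSteps w + if b = false then 1 else 0 := by
  simp only [downSteps, Finset.card_filter, Fin.sum_univ_castSucc, Fin.snoc_castSucc, Fin.snoc_last]

theorem psum_snoc {n : ℕ} (w : Fin n → Bool) (b : Bool) {t : ℕ} (ht : t ≤ n) :
    psum (Fin.snoc w b : Fin (n + 1) → Bool) t = psum w t := by
  simp [psum, Finset.sum_filter, Fin.sum_univ_castSucc, ht]

theorem psum_length {n : ℕ} (w : Fin n → Bool) : psum w n = n - 2 * (downSteps w : ℤ) := by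
  have h : ∀ b : Bool, pathStep b = 1 - 2 * (if b = false then 1 else 0) := by
    intro b; cases b <;> simp [pathStep]
  simp only [psum, downSteps, Finset.card_filter, Finset.sum_filter, h]
  simp [Finset.sum_sub_distrib, ← Finset.mul_sum, -mul_ite]

theorem numZeros_snoc {n : ℕ} (w : Fin n → Bool) (b : Bool) :
    numZeros (Fin.snoc w b : Fin (n + 1) → Bool) = numZeros w +
      if psum (Fin.snoc w b : Fin (n + 1) → Bool) (n + 1) = 0 then 1 else 0 := by
  simp only [numZeros, Finset.card_filter]
  rw [Finset.sum_range_succ]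
  congr 1
  refine Finset.sum_congr rfl fun t ht => ?_
  rw [psum_snoc w b (Nat.lt_succ_iff.mp (Finset.mem_range.mp ht))]

theorem card_paths (n ℓ : ℕ) : (paths n ℓ).card = n.choose ℓ := by
  have h : (Finset.powersetCard ℓ (Finset.univ : Finset (Fin n))).card = n.choose ℓ := by simp
  rw [← h]
  refine Finset.card_nbij' (fun w => Finset.univ.filter (fun i => w i = false))
    (fun s i => decide (i ∉ s)) ?_ ?_ ?_ ?_
  · intro w hw
    simpa [paths, Finset.mem_powersetCard] using hw
  · intro s hs
    simpa [paths, Finset.mem_powersetCard] using hs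
  · intro w _
    ext i
    simp
  · intro s _
    ext i
    simp

theorem sum_paths_eq_sum_pathProb (n : ℕ) (f : (Fin n → Bool) → ℝ) :
    (1 / ((n : ℝ) + 1)) * ∑ ℓ ∈ Finset.range (n + 1),
      (1 / (n.choose ℓ : ℝ)) * ∑ w ∈ paths n ℓ, f w = ∑ w, pathProb w * f w := by
  rw [← Finset.sum_fiberwise_of_maps_to (t := Finset.range (n + 1)) (g := downSteps)
    fun w _ => Finset.mem_range.mpr (Nat.lt_succ_of_le (downSteps_le w)), Finset.mul_sum]
  refine Finset.sum_congr rfl fun ℓ _ => ?_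
  rw [← mul_assoc, Finset.mul_sum]
  refine Finset.sum_congr rfl fun w hw => ?_
  rw [pathProb, (Finset.mem_filter.mp hw).2]

/-- The path measures of consecutive lengths are consistent. -/
theorem pathProb_snoc_add {n : ℕ} (w : Fin n → Bool) :
    pathProb (Fin.snoc w true : Fin (n + 1) → Bool) +
      pathProb (Fin.snoc w false : Fin (n + 1) → Bool) = pathProb w := by
  have hd := downSteps_le w
  simp only [pathProb, downSteps_snoc]
  simp only [Bool.true_eq_false, if_false, if_true, add_zero]
  generalize downSteps w = d at hd ⊢
  obtain ⟨k, rfl⟩ := Nat.exists_eq_add_of_le hd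
  have h₁ : (((d + k + 1).choose d : ℕ) : ℝ) * (k + 1) = (d + k + 1) * ((d + k).choose d : ℕ) := by
    have := Nat.add_one_mul_choose_eq (d + k) k
    rw [← Nat.choose_symm_add, ← Nat.choose_symm_of_eq_add (show d + k + 1 = d + (k + 1) by ring)]
      at this
    exact_mod_cast this.symm
  have h₂ : (((d + k + 1).choose (d + 1) : ℕ) : ℝ) * (d + 1) =
      (d + k + 1) * ((d + k).choose d : ℕ) := by
    exact_mod_cast (Nat.add_one_mul_choose_eq (d + k) d).symm
  have hc : (0 : ℝ) < ((d + k).choose d : ℕ) := by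
    exact_mod_cast Nat.choose_pos (Nat.le_add_right d k)
  rw [← eq_div_iff (by positivity)] at h₁ h₂
  rw [h₁, h₂]
  push_cast
  field_simp
  ring

theorem sum_pathProb_return (n : ℕ) :
    ∑ w : Fin n → Bool, pathProb w * (if psum w n = 0 then 1 else 0) =
      if Odd (n + 1) then (1 : ℝ) / ((n + 1 : ℕ) : ℝ) else 0 := by
  simp only [psum_length, mul_ite, mul_one, mul_zero]
  split_ifs with hn
  · obtain ⟨m, hm⟩ := hn
    obtain rfl : n = 2 * m := by omega
    have h : ∀ w : Fin (2 * m) → Bool,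
        (((2 * m : ℕ) : ℤ) - 2 * (downSteps w : ℤ) = 0) ↔ downSteps w = m := by
      intro w; omega
    simp only [h]
    rw [← Finset.sum_filter, Finset.sum_congr rfl (g := fun _ =>
      1 / (((2 * m : ℕ) : ℝ) + 1) * (1 / ((2 * m).choose m : ℝ)))
      fun w hw => by rw [pathProb, (Finset.mem_filter.mp hw).2]]
    have hcard : (Finset.univ.filter fun w : Fin (2 * m) → Bool => downSteps w = m).card =
        (2 * m).choose m := card_paths (2 * m) m
    have hc : (0 : ℝ) < ((2 * m).choose m : ℕ) := by
      exact_mod_cast Nat.choose_pos (by omega)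
    rw [Finset.sum_const, hcard, nsmul_eq_mul]
    push_cast
    field_simp
  · refine Finset.sum_eq_zero fun w _ => if_neg fun h => hn ?_
    exact ⟨downSteps w, by omega⟩

theorem sum_pathProb_mul_numZeros (n : ℕ) :
    ∑ w : Fin n → Bool, pathProb w * (numZeros w : ℝ) =
      ∑ m ∈ Finset.Icc 1 (n + 1), if Odd m then (1 : ℝ) / m else 0 := by
  induction n with
  | zero => simp [pathProb, numZeros, downSteps, psum]
  | succ n ih =>
    rw [Finset.sum_Icc_succ_top (by omega), ← ih, ← sum_pathProb_return]
    have key : ∀ f : (Fin (n + 1) → Bool) → ℝ, ∑ w, f w =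
        ∑ w : Fin n → Bool, (f (Fin.snoc w true) + f (Fin.snoc w false)) := by
      intro f
      rw [← (Fin.snocEquiv fun _ => Bool).sum_comp, Fintype.sum_prod_type]
      simp [Fin.snocEquiv, Finset.sum_add_distrib]
    rw [key, key, ← Finset.sum_add_distrib]
    refine Finset.sum_congr rfl fun w _ => ?_
    rw [← pathProb_snoc_add w, numZeros_snoc, numZeros_snoc]
    push_cast
    ring

/-- In the random lattice path model of length `n`, the expected number of zeros is
`H^odd_{n+1}`. -/
theorem expected_zeros_eq_odd_harmonic (n : ℕ) :
    (1 / ((n : ℝ) + 1)) * ∑ ℓ ∈ Finset.range (n + 1),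
      (1 / (n.choose ℓ : ℝ)) * ∑ w ∈ paths n ℓ, (numZeros w : ℝ)
    = ∑ m ∈ Finset.Icc 1 (n + 1), if Odd m then (1 : ℝ) / m else 0 := by
  rw [sum_paths_eq_sum_pathProb, sum_pathProb_mul_numZeros]
end

section
/- For every integer n ≥ 0, (4/(n+1)) Σ_{0≤k<ℓ<⌈n/2⌉} C(n,k)/C(n,ℓ) + [n even]·(1/(n+1))·(2^n/C(n,n/2) − 1) + 1 = Σ_{m=1}^{n+1} [m odd]/m. -/
/-- The partial row sum `∑_{k < l} C(n, k)` of Pascal's triangle, as a real number. -/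
noncomputable def choosePartialSum (n l : ℕ) : ℝ :=
  ∑ k ∈ Finset.range l, (n.choose k : ℝ)

/-- The sum over `l < h` of the partial row sums of Pascal's triangle divided by `C(n, l)`. -/
noncomputable def chooseRatioSum (n h : ℕ) : ℝ :=
  ∑ l ∈ Finset.range h, choosePartialSum n l / (n.choose l : ℝ)

theorem choosePartialSum_succ (n l : ℕ) :
    choosePartialSum n (l + 1) = choosePartialSum n l + (n.choose l : ℝ) :=
  Finset.sum_range_succ _ _

theorem chooseRatioSum_succ (n h : ℕ) :
    chooseRatioSum n (h + 1) = chooseRatioSum n h + choosePartialSum n h / (n.choose h : ℝ) :=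
  Finset.sum_range_succ _ _

theorem choosePartialSum_succ_succ (n l : ℕ) :
    choosePartialSum (n + 1) (l + 1) = 2 * choosePartialSum n l + (n.choose l : ℝ) := by
  induction l with
  | zero => simp [choosePartialSum]
  | succ l ih =>
    rw [choosePartialSum_succ, ih, choosePartialSum_succ, Nat.choose_succ_succ]
    push_cast
    ring

theorem choosePartialSum_halfway (p : ℕ) : choosePartialSum (2 * p + 1) (p + 1) = 4 ^ p := by
  unfold choosePartialSum
  exact_mod_cast Nat.sum_range_choose_halfway p

/-- Comparison of the ratio sums for consecutive rows, which follows from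
`1 / C(n, l) = (n + 1) / (n + 2) * (1 / C(n + 1, l) + 1 / C(n + 1, l + 1))`. -/
theorem chooseRatioSum_div_succ (n h : ℕ) (hn : h ≤ n + 1) :
    chooseRatioSum n h / (n + 1) = chooseRatioSum (n + 1) h / (n + 2)
      + (choosePartialSum (n + 1) h / ((n + 1).choose h : ℝ) - h / (n + 1)) / (2 * (n + 2)) := by
  induction h with
  | zero => simp [chooseRatioSum, choosePartialSum]
  | succ h ih =>
    have hle : h ≤ n := by omega
    have hc : (n.choose h : ℝ) ≠ 0 := by exact_mod_cast (Nat.choose_pos hle).ne'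
    have hd : (n : ℝ) + 1 - h ≠ 0 := by
      have : (h : ℝ) ≤ n := by exact_mod_cast hle
      linarith
    have h1 : ((n + 1).choose (h + 1) : ℝ) = n.choose h * (n + 1) / (h + 1) := by
      have := Nat.add_one_mul_choose_eq n h
      rw [eq_div_iff (by positivity)]
      exact_mod_cast (by rw [← this]; ring :
        (n + 1).choose (h + 1) * (h + 1) = n.choose h * (n + 1))
    have h2 : ((n + 1).choose h : ℝ) = n.choose h * (n + 1) / (n + 1 - h) := by
      have := congrArg (Nat.cast (R := ℝ)) (Nat.choose_mul_succ_eq n h)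
      rw [Nat.cast_mul, Nat.cast_mul, Nat.cast_sub (by omega)] at this
      rw [eq_div_iff hd]
      exact_mod_cast this.symm
    have h3 := choosePartialSum_succ_succ n h
    have h4 : choosePartialSum (n + 1) h =
        2 * choosePartialSum n h + n.choose h - (n + 1).choose h := by
      rw [← h3, choosePartialSum_succ]
      ring
    have key : choosePartialSum n h / n.choose h / (n + 1) =
        choosePartialSum (n + 1) h / ((n + 1).choose h : ℝ) / (n + 2)
        + (choosePartialSum (n + 1) (h + 1) / ((n + 1).choose (h + 1) : ℝ)
          - choosePartialSum (n + 1) h / ((n + 1).choose h : ℝ) - 1 / (n + 1))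
          / (2 * (n + 2)) := by
      rw [h3, h4, h1, h2]
      field_simp
      ring
    rw [chooseRatioSum_succ, chooseRatioSum_succ, add_div, ih (by omega), key]
    push_cast
    ring

theorem choose_two_mul_add_one (p : ℕ) :
    ((2 * p + 1).choose p : ℝ) = (2 * p).choose p * (2 * p + 1) / (p + 1) := by
  have := Nat.choose_mul_succ_eq (2 * p) p
  rw [show 2 * p + 1 - p = p + 1 by omega] at this
  rw [eq_div_iff (by positivity)]
  exact_mod_cast this.symm

/-- The ratio sum of an odd row in terms of that of the preceding even row. -/
theorem chooseRatioSum_odd (p : ℕ) :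
    4 / (2 * p + 2) * chooseRatioSum (2 * p + 1) (p + 1) =
      4 / (2 * p + 1) * chooseRatioSum (2 * p) p
        + 1 / (2 * p + 1) * (2 ^ (2 * p) / (2 * p).choose p - 1) := by
  have h := chooseRatioSum_div_succ (2 * p) p (by omega)
  have hA := choosePartialSum_halfway p
  rw [choosePartialSum_succ] at hA
  have hc : ((2 * p).choose p : ℝ) ≠ 0 := by
    exact_mod_cast (Nat.choose_pos (by omega : p ≤ 2 * p)).ne'
  have e : 4 / (2 * p + 1) * chooseRatioSum (2 * p) p =
      4 * (chooseRatioSum (2 * p) p / ((2 * p : ℕ) + 1)) := by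
    push_cast; ring
  rw [e, h, chooseRatioSum_succ, eq_sub_of_add_eq hA, choose_two_mul_add_one, pow_mul]
  push_cast
  norm_num
  field_simp
  ring

/-- The ratio sum of an even row in terms of that of the preceding odd row. -/
theorem chooseRatioSum_even (p : ℕ) :
    4 / (2 * p + 3) * chooseRatioSum (2 * p + 2) (p + 1)
        + 1 / (2 * p + 3) * (2 ^ (2 * p + 2) / (2 * p + 2).choose (p + 1) - 1) =
      4 / (2 * p + 2) * chooseRatioSum (2 * p + 1) (p + 1) + 1 / (2 * p + 3) := by
  have h := chooseRatioSum_div_succ (2 * p + 1) (p + 1) (by omega)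
  have hA := choosePartialSum_succ (2 * p + 2) (p + 1)
  have hB := choosePartialSum_succ_succ (2 * p + 1) (p + 1)
  have hS : (2 * p + 1).choose (p + 1) = (2 * p + 1).choose p := Nat.choose_symm_half p
  have hC : ((2 * p + 2).choose (p + 1) : ℝ) = 2 * (2 * p + 1).choose p := by
    rw [Nat.choose_succ_succ, hS]
    push_cast; ring
  rw [choosePartialSum_halfway, hS] at hB
  have hc : ((2 * p + 1).choose p : ℝ) ≠ 0 := by
    exact_mod_cast (Nat.choose_pos (by omega : p ≤ 2 * p + 1)).ne'
  have hD : choosePartialSum (2 * p + 2) (p + 1) = 2 * 4 ^ p - (2 * p + 1).choose p := by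
    rw [hC] at hA
    linarith
  have e : 4 / (2 * p + 2) * chooseRatioSum (2 * p + 1) (p + 1) =
      4 * (chooseRatioSum (2 * p + 1) (p + 1) / ((2 * p + 1 : ℕ) + 1)) := by
    push_cast; ring
  rw [e, h, hD, hC, pow_add, pow_mul]
  push_cast
  norm_num
  field_simp
  ring

/-- The identity for the row `2 * p + 1`, in terms of the sum of `1 / m` over odd `m`. -/
theorem chooseRatioSum_odd_eq_sum (p : ℕ) :
    4 / (2 * p + 2) * chooseRatioSum (2 * p + 1) (p + 1) + 1 =
      ∑ m ∈ Finset.Icc 1 (2 * p + 1), if Odd m then (1 : ℝ) / m else 0 := by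
  induction p with
  | zero => simp [chooseRatioSum, choosePartialSum]
  | succ p ih =>
    have h1 := chooseRatioSum_odd (p + 1)
    have h2 := chooseRatioSum_even p
    rw [show 2 * (p + 1) + 1 = 2 * p + 1 + 1 + 1 by ring, Finset.sum_Icc_succ_top (by omega),
      Finset.sum_Icc_succ_top (by omega), ← ih, if_neg (by grind), if_pos (by grind)]
    rw [show 2 * (p + 1) + 1 = 2 * p + 1 + 1 + 1 by ring,
      show 2 * (p + 1) = 2 * p + 2 by ring] at h1
    push_cast at h1 ⊢
    rw [show (2 * (p : ℝ) + 2 + 1) = 2 * p + 3 by ring]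
    rw [show (2 * ((p : ℝ) + 1) + 1) = 2 * p + 3 by ring] at h1
    linarith



/-- The combinatorial identity: for every `n ≥ 0`,
`(4/(n+1)) Σ_{0≤k<ℓ<⌈n/2⌉} C(n,k)/C(n,ℓ) + [n even]·(1/(n+1))·(2^n/C(n,n/2) − 1) + 1
 = Σ_{m=1}^{n+1} [m odd]/m`. Here `⌈n/2⌉ = (n+1)/2` (natural division). -/
theorem double_sum_identity (n : ℕ) :
    (4 / ((n : ℝ) + 1)) * ∑ ℓ ∈ Finset.range ((n + 1) / 2), ∑ k ∈ Finset.range ℓ,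
        (n.choose k : ℝ) / (n.choose ℓ : ℝ)
      + (if Even n then (1 / ((n : ℝ) + 1)) * ((2 : ℝ) ^ n / (n.choose (n / 2) : ℝ) - 1) else 0)
      + 1
    = ∑ m ∈ Finset.Icc 1 (n + 1), if Odd m then (1 : ℝ) / m else 0 := by
  have hT (h : ℕ) : ∑ ℓ ∈ Finset.range h, ∑ k ∈ Finset.range ℓ,
      (n.choose k : ℝ) / (n.choose ℓ : ℝ) = chooseRatioSum n h := by
    simp only [chooseRatioSum, choosePartialSum, Finset.sum_div]
  rw [hT]
  obtain ⟨p, rfl | rfl⟩ := n.even_or_odd'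
  · rw [if_pos (by simp), show (2 * p + 1) / 2 = p by omega, show 2 * p / 2 = p by omega,
      ← chooseRatioSum_odd_eq_sum, chooseRatioSum_odd]
    push_cast
    ring
  · rw [if_neg (by grind), show (2 * p + 1 + 1) / 2 = p + 1 by omega,
      Finset.sum_Icc_succ_top (by omega), ← chooseRatioSum_odd_eq_sum, if_neg (by grind)]
    push_cast
    ring
end

section
/- For every integer n ≥ 0, (1/(n+1)) Σ_{m=0}^{⌊n/2⌋} Σ_{ℓ=m}^{n−m} C(2m,m)·C(n−2m,ℓ−m)/C(n,ℓ) = Σ_{m=1}^{n+1} [m odd]/m. -/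
theorem sum_range_choose_mul_choose_sub (n a b : ℕ) :
    ∑ l ∈ Finset.range (n + 1), l.choose a * (n - l).choose b = (n + 1).choose (a + b + 1) := by
  induction n generalizing b with
  | zero =>
    cases a <;> cases b <;> simp <;> exact (Nat.choose_eq_zero_of_lt (by omega)).symm
  | succ n ih =>
    rw [Finset.sum_range_succ]
    cases b with
    | zero =>
      have h := ih 0
      simp only [Nat.choose_zero_right, mul_one, add_zero] at h ⊢
      rw [h, Nat.choose_succ_succ (n + 1) a, add_comm]
    | succ b =>
      have h : ∀ l ∈ Finset.range (n + 1), l.choose a * (n + 1 - l).choose (b + 1) =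
          l.choose a * (n - l).choose b + l.choose a * (n - l).choose (b + 1) := by
        intro l hl
        rw [Nat.succ_sub (Finset.mem_range_succ_iff.mp hl), Nat.succ_eq_add_one,
          Nat.choose_succ_succ, mul_add]
      rw [Finset.sum_congr rfl h, Finset.sum_add_distrib, ih b, ih (b + 1)]
      simp [Nat.choose_succ_succ (n + 1) (a + b + 1), ← add_assoc]

theorem centralBinom_mul_choose_div_choose {n m l : ℕ} (hm : m ≤ l) (hl : l + m ≤ n) :
    ((2 * m).choose m : ℝ) * ((n - 2 * m).choose (l - m) : ℝ) / (n.choose l : ℝ) =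
      ((l.choose m * (n - l).choose m : ℕ) : ℝ) / (n.choose (2 * m) : ℝ) := by
  obtain ⟨i, rfl⟩ := Nat.exists_eq_add_of_le hm
  obtain ⟨j, rfl⟩ := Nat.exists_eq_add_of_le hl
  have e₁ : m + i + m + j - 2 * m = i + j := by omega
  have e₂ : m + i + m + j - (m + i) = m + j := by omega
  have e₃ : m + i - m = i := by omega
  have h₁ : m + i + m + j = (m + i) + (m + j) := by omega
  have h₂ : m + i + m + j = 2 * m + (i + j) := by omega
  rw [e₁, e₂, e₃, Nat.cast_mul]
  have c₁ : ((m + i + m + j).choose (m + i) : ℝ) =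
      (m + i + m + j).factorial / ((m + i).factorial * (m + j).factorial) := by
    rw [h₁, Nat.cast_add_choose]
  have c₂ : ((m + i + m + j).choose (2 * m) : ℝ) =
      (m + i + m + j).factorial / ((2 * m).factorial * (i + j).factorial) := by
    rw [h₂, Nat.cast_add_choose]
  rw [c₁, c₂, two_mul, Nat.cast_add_choose, Nat.cast_add_choose, Nat.cast_add_choose,
    Nat.cast_add_choose]
  have hf : ∀ k : ℕ, (k.factorial : ℝ) ≠ 0 := fun k => Nat.cast_ne_zero.mpr k.factorial_ne_zero
  have := hf m
  have := hf i
  have := hf j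
  have := hf (m + m)
  have := hf (i + j)
  have := hf (m + i)
  have := hf (m + j)
  have := hf (m + i + m + j)
  field_simp

theorem sum_centralBinom_mul_choose_div_choose {n m : ℕ} (h : 2 * m ≤ n) :
    ∑ l ∈ Finset.Icc m (n - m),
        ((2 * m).choose m : ℝ) * ((n - 2 * m).choose (l - m) : ℝ) / (n.choose l : ℝ) =
      ((n : ℝ) + 1) / ((2 * m + 1 : ℕ) : ℝ) := by
  have hsum : ∑ l ∈ Finset.Icc m (n - m), l.choose m * (n - l).choose m =
      (n + 1).choose (2 * m + 1) := by
    rw [two_mul, ← sum_range_choose_mul_choose_sub]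
    refine Finset.sum_subset (fun l hl => ?_) (fun l hl hl' => ?_)
    · simp only [Finset.mem_Icc, Finset.mem_range] at *
      omega
    · simp only [Finset.mem_Icc, Finset.mem_range, not_and_or, not_le] at *
      rcases hl' with hl' | hl'
      · rw [Nat.choose_eq_zero_of_lt hl', zero_mul]
      · rw [Nat.choose_eq_zero_of_lt (show n - l < m by omega), mul_zero]
  have hterm : ∀ l ∈ Finset.Icc m (n - m),
      ((2 * m).choose m : ℝ) * ((n - 2 * m).choose (l - m) : ℝ) / (n.choose l : ℝ) =
        ((l.choose m * (n - l).choose m : ℕ) : ℝ) / (n.choose (2 * m) : ℝ) := by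
    intro l hl
    rw [Finset.mem_Icc] at hl
    exact centralBinom_mul_choose_div_choose hl.1 (by omega)
  rw [Finset.sum_congr rfl hterm, ← Finset.sum_div, ← Nat.cast_sum, hsum,
    div_eq_div_iff (Nat.cast_ne_zero.mpr (Nat.choose_pos h).ne')
      (Nat.cast_ne_zero.mpr (Nat.succ_ne_zero _))]
  exact_mod_cast (Nat.add_one_mul_choose_eq n (2 * m)).symm

theorem sum_Icc_ite_odd {M : Type*} [AddCommMonoid M] (f : ℕ → M) (n : ℕ) :
    (∑ m ∈ Finset.Icc 1 (n + 1), if Odd m then f m else 0) =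
      ∑ m ∈ Finset.range (n / 2 + 1), f (2 * m + 1) := by
  rw [← Finset.sum_filter]
  symm
  refine Finset.sum_bij (fun m _ => 2 * m + 1) (fun m hm => ?_) (fun a _ b _ hab => ?_)
    (fun k hk => ?_) (fun _ _ => rfl)
  · simp only [Finset.mem_filter, Finset.mem_Icc, Finset.mem_range] at *
    exact ⟨by omega, m, rfl⟩
  · omega
  · simp only [Finset.mem_filter, Finset.mem_Icc] at hk
    obtain ⟨hk, m, rfl⟩ := hk
    exact ⟨m, Finset.mem_range.mpr (by omega), rfl⟩

/-- The combinatorial identity: for every `n ≥ 0`,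
`(1/(n+1)) Σ_{m=0}^{⌊n/2⌋} Σ_{ℓ=m}^{n−m} C(2m,m)·C(n−2m,ℓ−m)/C(n,ℓ) = Σ_{m=1}^{n+1} [m odd]/m`. -/
theorem quicksort_sum_identity (n : ℕ) :
    (1 / ((n : ℝ) + 1)) * ∑ m ∈ Finset.range (n / 2 + 1), ∑ ℓ ∈ Finset.Icc m (n - m),
        ((2 * m).choose m : ℝ) * ((n - 2 * m).choose (ℓ - m) : ℝ) / (n.choose ℓ : ℝ)
    = ∑ m ∈ Finset.Icc 1 (n + 1), if Odd m then (1 : ℝ) / m else 0 := by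
  rw [sum_Icc_ite_odd (fun m : ℕ => (1 : ℝ) / m), Finset.mul_sum]
  refine Finset.sum_congr rfl fun m hm => ?_
  rw [Finset.mem_range] at hm
  rw [sum_centralBinom_mul_choose_div_choose (by omega)]
  have : (n : ℝ) + 1 ≠ 0 := by positivity
  field_simp
end

section
/- For integers n ≥ 0 and 0 ≤ ℓ ≤ n define the real numbers F(n,ℓ) = Σ_{0≤k<ℓ} C(n,k)/C(n,ℓ) and G(n,ℓ) = (ℓ−1) + (ℓ−1−n)·F(n,ℓ). Then for all integers 0 ≤ ℓ < n, (n+1)·F(n+1,ℓ) − (n+2)·F(n,ℓ) = G(n,ℓ+1) − G(n,ℓ). -/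
/-- `F(n,ℓ) = Σ_{0≤k<ℓ} C(n,k)/C(n,ℓ)`. -/
noncomputable def F (n ℓ : ℕ) : ℝ :=
  ∑ k ∈ Finset.range ℓ, (n.choose k : ℝ) / (n.choose ℓ : ℝ)

/-- `G(n,ℓ) = (ℓ−1) + (ℓ−1−n)·F(n,ℓ)`. -/
noncomputable def G (n ℓ : ℕ) : ℝ :=
  ((ℓ : ℝ) - 1) + ((ℓ : ℝ) - 1 - (n : ℝ)) * F n ℓ

theorem F_eq_sum_div (n ℓ : ℕ) :
    F n ℓ = (∑ k ∈ Finset.range ℓ, (n.choose k : ℝ)) / n.choose ℓ := by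
  rw [F, Finset.sum_div]

theorem sum_range_choose_succ_add (n ℓ : ℕ) :
    (∑ k ∈ Finset.range (ℓ + 1), ((n + 1).choose k : ℝ)) + n.choose ℓ =
      2 * ∑ k ∈ Finset.range (ℓ + 1), (n.choose k : ℝ) := by
  induction ℓ with
  | zero => norm_num
  | succ ℓ ih =>
    rw [Finset.sum_range_succ, Finset.sum_range_succ _ (ℓ + 1), Nat.choose_succ_succ' n ℓ]
    push_cast
    linarith

theorem cast_choose_succ_mul {n ℓ : ℕ} (h : ℓ ≤ n) :
    (n.choose (ℓ + 1) : ℝ) * (ℓ + 1) = n.choose ℓ * (n - ℓ) := by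
  rw [← Nat.cast_sub h]
  exact_mod_cast Nat.choose_succ_right_eq n ℓ

theorem sum_range_choose_succ_mul {n ℓ : ℕ} (h : ℓ ≤ n) :
    (∑ k ∈ Finset.range ℓ, ((n + 1).choose k : ℝ)) * (n + 1 - ℓ) =
      2 * (n + 1 - ℓ) * (∑ k ∈ Finset.range ℓ, (n.choose k : ℝ)) - ℓ * n.choose ℓ := by
  cases ℓ with
  | zero => simp
  | succ ℓ =>
    have hsum := sum_range_choose_succ_add n ℓ
    have hchoose := cast_choose_succ_mul (Nat.le_of_succ_le h)
    push_cast
    linear_combination ((n : ℝ) - ℓ) * hsum + hchoose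

/-- The recurrence of `F` in its first argument. -/
theorem succ_mul_F_succ_left {n ℓ : ℕ} (h : ℓ ≤ n) :
    ((n : ℝ) + 1) * F (n + 1) ℓ = 2 * (n + 1 - ℓ) * F n ℓ - ℓ := by
  have hc : (n.choose ℓ : ℝ) ≠ 0 := mod_cast (Nat.choose_pos h).ne'
  have hc' : ((n + 1).choose ℓ : ℝ) ≠ 0 := mod_cast (Nat.choose_pos (Nat.le_succ_of_le h)).ne'
  have hchoose : (n.choose ℓ : ℝ) * (n + 1) = (n + 1).choose ℓ * (n + 1 - ℓ) := by
    have := Nat.choose_mul_succ_eq n ℓ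
    rify [Nat.le_succ_of_le h] at this
    exact this
  have hsum := sum_range_choose_succ_mul h
  rw [F_eq_sum_div, F_eq_sum_div]
  field_simp
  linear_combination (∑ k ∈ Finset.range ℓ, ((n + 1).choose k : ℝ)) * hchoose +
    ((n + 1).choose ℓ : ℝ) * hsum

/-- The recurrence of `F` in its second argument. -/
theorem sub_mul_F_succ_right {n ℓ : ℕ} (h : ℓ < n) :
    ((n : ℝ) - ℓ) * F n (ℓ + 1) = (ℓ + 1) * (F n ℓ + 1) := by
  have hc : (n.choose ℓ : ℝ) ≠ 0 := mod_cast (Nat.choose_pos h.le).ne'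
  have hc' : (n.choose (ℓ + 1) : ℝ) ≠ 0 := mod_cast (Nat.choose_pos h).ne'
  have hchoose := cast_choose_succ_mul h.le
  rw [F_eq_sum_div, F_eq_sum_div, Finset.sum_range_succ]
  field_simp
  linear_combination -hchoose

/-- The creative telescoping relation:
for `0 ≤ ℓ < n`, `(n+1)F(n+1,ℓ) − (n+2)F(n,ℓ) = G(n,ℓ+1) − G(n,ℓ)`. -/
theorem creative_telescoping (n ℓ : ℕ) (h : ℓ < n) :
    ((n : ℝ) + 1) * F (n + 1) ℓ - ((n : ℝ) + 2) * F n ℓ = G n (ℓ + 1) - G n ℓ := by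
  rw [G, G]
  push_cast
  linear_combination succ_mul_F_succ_left h.le + sub_mul_F_succ_right h
end

section
/- For n ≥ 0 define E_n = (4/(n+1)) Σ_{0≤k<ℓ<⌈n/2⌉} C(n,k)/C(n,ℓ) + [n even]·(1/(n+1))·(2^n/C(n,n/2) − 1). Then for every integer N ≥ 0, E_{2N+1} − E_{2N} = 0 and E_{2N+2} − E_{2N+1} = 1/(2N+3). -/
/-- `E_n = (4/(n+1)) Σ_{0≤k<ℓ<⌈n/2⌉} C(n,k)/C(n,ℓ) + [n even]·(1/(n+1))·(2^n/C(n,n/2) − 1)`,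
with `⌈n/2⌉ = (n+1)/2` (natural division). -/
noncomputable def E (n : ℕ) : ℝ :=
  (4 / ((n : ℝ) + 1)) * ∑ ℓ ∈ Finset.range ((n + 1) / 2), ∑ k ∈ Finset.range ℓ,
      (n.choose k : ℝ) / (n.choose ℓ : ℝ)
    + (if Even n then (1 / ((n : ℝ) + 1)) * ((2 : ℝ) ^ n / (n.choose (n / 2) : ℝ) - 1) else 0)

open Finset in
theorem sum_range_choose_succ_succ (n l : ℕ) :
    ∑ k ∈ range (l + 1), ((n + 1).choose k : ℝ) =
      2 * ∑ k ∈ range l, (n.choose k : ℝ) + n.choose l := by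
  induction l with
  | zero => simp
  | succ l ih =>
    rw [sum_range_succ, ih, sum_range_succ, Nat.choose_succ_succ]
    push_cast
    ring

open Finset in
theorem sum_range_choose_div_choose_succ {n l : ℕ} (h : l ≤ n) :
    (∑ k ∈ range l, ((n + 1).choose k : ℝ)) / (n + 1).choose l +
        (∑ k ∈ range (l + 1), ((n + 1).choose k : ℝ)) / (n + 1).choose (l + 1) =
      2 * ((n : ℝ) + 2) / (n + 1) * ((∑ k ∈ range l, (n.choose k : ℝ)) / n.choose l) +
        1 / ((n : ℝ) + 1) := by
  have hpos : (0 : ℝ) < n.choose l := by exact_mod_cast Nat.choose_pos h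
  have hl : (0 : ℝ) < n + 1 - l := by
    have : (l : ℝ) ≤ n := by exact_mod_cast h
    linarith
  have hn : (n : ℝ) + 1 ≠ 0 := by positivity
  have hl1 : (l : ℝ) + 1 ≠ 0 := by positivity
  have e₁ : ((n + 1).choose (l + 1) : ℝ) = (n + 1) * n.choose l / (l + 1) := by
    rw [eq_div_iff hl1]
    exact_mod_cast (Nat.add_one_mul_choose_eq n l).symm
  have e₂ : ((n + 1).choose l : ℝ) = (n + 1) * n.choose l / (n + 1 - l) := by
    rw [eq_div_iff hl.ne']
    have := congrArg (Nat.cast (R := ℝ)) (Nat.choose_mul_succ_eq n l)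
    rw [Nat.cast_mul, Nat.cast_mul, Nat.cast_sub (by omega)] at this
    push_cast at this
    linarith
  have e₃ : ∑ k ∈ range l, ((n + 1).choose k : ℝ) =
      2 * ∑ k ∈ range l, (n.choose k : ℝ) + n.choose l - (n + 1).choose l := by
    rw [← sum_range_choose_succ_succ, sum_range_succ]
    ring
  rw [e₃, sum_range_choose_succ_succ, e₁, e₂]
  have hl' := hl.ne'
  have hpos' := hpos.ne'
  field_simp
  ring

open Finset in
theorem sum_sum_choose_div_choose_succ {n L : ℕ} (h : L ≤ n + 1) :
    4 / ((n : ℝ) + 2) * ∑ l ∈ range L, (∑ k ∈ range l, ((n + 1).choose k : ℝ)) / (n + 1).choose l =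
      4 / ((n : ℝ) + 1) * ∑ l ∈ range L, (∑ k ∈ range l, (n.choose k : ℝ)) / n.choose l -
        2 / ((n : ℝ) + 2) * ((∑ k ∈ range L, ((n + 1).choose k : ℝ)) / (n + 1).choose L) +
        2 * L / (((n : ℝ) + 1) * (n + 2)) := by
  induction L with
  | zero => simp
  | succ L ih =>
    have step := sum_range_choose_div_choose_succ (n := n) (l := L) (by omega)
    rw [sum_range_succ _ L, sum_range_succ _ L, mul_add, ih (by omega), eq_sub_of_add_eq' step]
    push_cast
    have h1 : (n : ℝ) + 1 ≠ 0 := by positivity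
    have h2 : (n : ℝ) + 2 ≠ 0 := by positivity
    field_simp
    ring

open Finset in
theorem sum_range_choose_halfway_real (N : ℕ) :
    ∑ k ∈ range N, ((2 * N + 1).choose k : ℝ) + (2 * N + 1).choose N = 2 ^ (2 * N) := by
  rw [← sum_range_succ, pow_mul]
  norm_num
  exact_mod_cast Nat.sum_range_choose_halfway N

/-- For every `N ≥ 0`: `E_{2N+1} − E_{2N} = 0` and `E_{2N+2} − E_{2N+1} = 1/(2N+3)`. -/
theorem E_recurrence (N : ℕ) :
    E (2 * N + 1) - E (2 * N) = 0 ∧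
    E (2 * N + 2) - E (2 * N + 1) = 1 / (2 * (N : ℝ) + 3) := by
  have hodd : ¬ Even (2 * N + 1) := by simp
  have heven : Even (2 * N + 2) := ⟨N + 1, by ring⟩
  have d₁ : (2 * N + 1) / 2 = N := by omega
  have d₂ : (2 * N + 1 + 1) / 2 = N + 1 := by omega
  have d₃ : (2 * N + 2 + 1) / 2 = N + 1 := by omega
  have d₄ : 2 * N / 2 = N := by omega
  have half := sum_range_choose_halfway_real N
  have hN1 : (N : ℝ) + 1 ≠ 0 := by positivity
  have h2N1 : 2 * (N : ℝ) + 1 ≠ 0 := by positivity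
  have h2N2 : 2 * (N : ℝ) + 2 ≠ 0 := by positivity
  have h2N3 : 2 * (N : ℝ) + 3 ≠ 0 := by positivity
  simp only [E, d₁, d₂, d₃, d₄, if_neg hodd, if_pos heven, if_pos (even_two_mul N),
    ← Finset.sum_div]
  constructor
  · have key := sum_sum_choose_div_choose_succ (n := 2 * N) (L := N) (by omega)
    have hc : ((2 * N).choose N : ℝ) ≠ 0 := by
      exact_mod_cast (Nat.choose_pos (by omega)).ne'
    have e : ((2 * N + 1).choose N : ℝ) = (2 * N + 1) * (2 * N).choose N / (N + 1) := by
      rw [eq_div_iff hN1]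
      have := Nat.choose_mul_succ_eq (2 * N) N
      rw [show 2 * N + 1 - N = N + 1 by omega] at this
      have := congrArg (Nat.cast (R := ℝ)) this
      push_cast at this
      linarith
    rw [Finset.sum_range_succ, eq_sub_of_add_eq half, e]
    rw [eq_sub_of_add_eq half, e] at key
    push_cast at key ⊢
    rw [show 2 * (N : ℝ) + 1 + 1 = 2 * N + 2 by ring, mul_add, key]
    rw [show 2 * (N : ℝ) + 2 = 2 * (N + 1) by ring]
    field_simp
    ring
  · have key := sum_sum_choose_div_choose_succ (n := 2 * N + 1) (L := N + 1) (by omega)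
    have hc : ((2 * N + 1).choose N : ℝ) ≠ 0 := by
      exact_mod_cast (Nat.choose_pos (by omega)).ne'
    have e : ((2 * N + 2).choose (N + 1) : ℝ) = 2 * (2 * N + 1).choose N := by
      rw [Nat.choose_succ_succ, Nat.choose_symm_half]
      push_cast
      ring
    rw [sum_range_choose_succ_succ, eq_sub_of_add_eq half, show 2 * N + 1 + 1 = 2 * N + 2 from rfl,
      e] at key
    rw [e]
    push_cast at key ⊢
    rw [show 2 * (N : ℝ) + 1 + 2 = 2 * N + 3 by ring] at key
    rw [show 2 * (N : ℝ) + 2 + 1 = 2 * N + 3 by ring, key]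
    rw [show 2 * (N : ℝ) + 1 + 1 = 2 * (N + 1) by ring]
    field_simp
    ring
end

section
/- For n ≥ 0 define S_n = Σ_{0≤k<ℓ<⌈n/2⌉} C(n,k)/C(n,ℓ) as a real number. Then for every integer n ≥ 2, S_n = ((n+1)/(n−1))·S_{n−2} + (n+1)/(4n) + [n even]·( 2^{n−2}/(n·C(n,n/2)) − 1/(2(n−1)) − 1/(4n) ). -/
/-- `S_n = Σ_{0≤k<ℓ<⌈n/2⌉} C(n,k)/C(n,ℓ)`, with `⌈n/2⌉ = (n+1)/2` (natural division). -/
noncomputable def S (n : ℕ) : ℝ :=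
  ∑ ℓ ∈ Finset.range ((n + 1) / 2), ∑ k ∈ Finset.range ℓ,
    (n.choose k : ℝ) / (n.choose ℓ : ℝ)

/-- The partial row sums of Pascal's triangle, as real numbers. -/
noncomputable def chooseRowSum (n ℓ : ℕ) : ℝ :=
  ∑ k ∈ Finset.range ℓ, (n.choose k : ℝ)

theorem chooseRowSum_succ (n ℓ : ℕ) :
    chooseRowSum n (ℓ + 1) = chooseRowSum n ℓ + (n.choose ℓ : ℝ) :=
  Finset.sum_range_succ _ _

theorem chooseRowSum_succ_succ (n ℓ : ℕ) :
    chooseRowSum (n + 1) (ℓ + 1) = chooseRowSum n (ℓ + 1) + chooseRowSum n ℓ := by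
  induction ℓ with
  | zero => simp [chooseRowSum]
  | succ ℓ ih =>
    rw [chooseRowSum_succ, ih, chooseRowSum_succ n (ℓ + 1), chooseRowSum_succ n ℓ,
      Nat.choose_succ_succ]
    push_cast
    ring

theorem chooseRowSum_two_mul_add_one (p : ℕ) :
    chooseRowSum (2 * p + 1) (p + 1) = 4 ^ p := by
  unfold chooseRowSum
  exact_mod_cast Nat.sum_range_choose_halfway p

theorem S_eq_sum_chooseRowSum (n : ℕ) :
    S n = ∑ ℓ ∈ Finset.range ((n + 1) / 2), chooseRowSum n ℓ / (n.choose ℓ : ℝ) := by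
  simp only [S, chooseRowSum, Finset.sum_div]

theorem inv_choose_add_inv_choose_succ {n ℓ : ℕ} (h : ℓ ≤ n) :
    1 / ((n + 1).choose ℓ : ℝ) + 1 / ((n + 1).choose (ℓ + 1) : ℝ)
      = ((n : ℝ) + 2) / (n + 1) * (1 / (n.choose ℓ : ℝ)) := by
  obtain ⟨d, rfl⟩ := Nat.exists_eq_add_of_le h
  have h0 : ((ℓ + d).choose ℓ : ℝ) ≠ 0 := by
    exact_mod_cast (Nat.choose_pos h).ne'
  have h1 : ((ℓ + d + 1).choose ℓ : ℝ)
      = ((ℓ + d).choose ℓ : ℝ) * (ℓ + d + 1) / (d + 1) := by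
    have := Nat.choose_mul_succ_eq (ℓ + d) ℓ
    rw [show ℓ + d + 1 - ℓ = d + 1 by omega] at this
    rw [eq_div_iff (by positivity)]
    exact_mod_cast this.symm
  have h2 : ((ℓ + d + 1).choose (ℓ + 1) : ℝ)
      = ((ℓ + d).choose ℓ : ℝ) * (ℓ + d + 1) / (ℓ + 1) := by
    have := Nat.add_one_mul_choose_eq (ℓ + d) ℓ
    rw [eq_div_iff (by positivity), mul_comm ((ℓ + d).choose ℓ : ℝ)]
    exact_mod_cast this.symm
  rw [h1, h2]
  have h3 : (ℓ : ℝ) + d + 1 ≠ 0 := by positivity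
  push_cast
  field_simp
  ring

theorem inv_choose_second_order {n ℓ : ℕ} (h : ℓ ≤ n) :
    1 / ((n + 2).choose ℓ : ℝ) + 2 * (1 / ((n + 2).choose (ℓ + 1) : ℝ))
        + 1 / ((n + 2).choose (ℓ + 2) : ℝ)
      = ((n : ℝ) + 3) / (n + 1) * (1 / (n.choose ℓ : ℝ)) := by
  have h1 := inv_choose_add_inv_choose_succ (n := n + 1) (ℓ := ℓ) (by omega)
  have h2 := inv_choose_add_inv_choose_succ (n := n + 1) (ℓ := ℓ + 1) (by omega)
  have h3 := inv_choose_add_inv_choose_succ h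
  have h4 : ((n : ℝ) + 3) / (n + 1)
      = (((n + 1 : ℕ) : ℝ) + 2) / (((n + 1 : ℕ) : ℝ) + 1) * (((n : ℝ) + 2) / (n + 1)) := by
    push_cast
    field_simp
    ring
  rw [h4, mul_assoc, ← h3, mul_add, ← h1, ← h2]
  ring

theorem sum_chooseRowSum_div_choose (n M : ℕ) (h : M ≤ n) :
    ∑ ℓ ∈ Finset.range (M + 2), chooseRowSum (n + 2) ℓ / ((n + 2).choose ℓ : ℝ)
      = ((n : ℝ) + 3) / (n + 1)
          * ∑ ℓ ∈ Finset.range (M + 1), chooseRowSum n ℓ / (n.choose ℓ : ℝ)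
        + chooseRowSum n (M + 1) / ((n + 2).choose (M + 1) : ℝ)
        - chooseRowSum n M / ((n + 2).choose (M + 2) : ℝ) := by
  induction M with
  | zero => simp [Finset.sum_range_succ, chooseRowSum]
  | succ M ih =>
    have hq := inv_choose_second_order h
    have hT : chooseRowSum (n + 2) (M + 2)
        = chooseRowSum n (M + 2) + 2 * chooseRowSum n (M + 1) + chooseRowSum n M := by
      rw [chooseRowSum_succ_succ (n + 1), chooseRowSum_succ_succ n,
        chooseRowSum_succ_succ n]
      ring
    rw [Finset.sum_range_succ, ih (by omega), Finset.sum_range_succ _ (M + 1), hT]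
    linear_combination (chooseRowSum n (M + 1)) * hq

theorem S_add_two (n M : ℕ) (hM : (n + 1) / 2 = M + 1) :
    S (n + 2) = ((n : ℝ) + 3) / (n + 1) * S n
        + chooseRowSum n (M + 1) / ((n + 2).choose (M + 1) : ℝ)
        - chooseRowSum n M / ((n + 2).choose (M + 2) : ℝ) := by
  rw [S_eq_sum_chooseRowSum, S_eq_sum_chooseRowSum, hM,
    show (n + 2 + 1) / 2 = M + 2 by omega, sum_chooseRowSum_div_choose n M (by omega)]

theorem choose_two_mul_add_three (p : ℕ) :
    ((2 * p + 3).choose (p + 1) : ℝ)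
      = ((2 * p + 1).choose p : ℝ) * (2 * (2 * p + 3)) / (p + 2) := by
  have h1 := Nat.choose_mul_succ_eq (2 * p + 1) p
  rw [show 2 * p + 1 + 1 - p = p + 2 by omega] at h1
  have h2 : (2 * p + 3).choose (p + 1) = (2 * p + 2).choose p
      + ((2 * p + 1).choose p + (2 * p + 1).choose (p + 1)) := by
    rw [Nat.choose_succ_succ (2 * p + 2) p, Nat.choose_succ_succ (2 * p + 1) p]
  rw [Nat.choose_symm_half] at h2
  have h1' : ((2 * p + 1).choose p : ℝ) * (2 * p + 2)
      = ((2 * p + 2).choose p : ℝ) * (p + 2) := by exact_mod_cast h1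
  rw [h2, eq_div_iff (by positivity)]
  push_cast
  linear_combination -h1'

theorem S_two_mul_add_three (p : ℕ) :
    S (2 * p + 3) = (2 * (p : ℝ) + 4) / (2 * p + 2) * S (2 * p + 1)
      + (2 * (p : ℝ) + 4) / (4 * (2 * p + 3)) := by
  have h0 : ((2 * p + 1).choose p : ℝ) ≠ 0 := by
    exact_mod_cast (Nat.choose_pos (by omega)).ne'
  have hs : (2 * p + 3).choose (p + 2) = (2 * p + 3).choose (p + 1) :=
    Nat.choose_symm_half (p + 1)
  rw [S_add_two (2 * p + 1) p (by omega), show 2 * p + 1 + 2 = 2 * p + 3 by ring, hs,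
    chooseRowSum_succ, choose_two_mul_add_three]
  push_cast
  field_simp
  ring

theorem S_two_mul_add_four (p : ℕ) :
    S (2 * p + 4) = (2 * (p : ℝ) + 5) / (2 * p + 3) * S (2 * p + 2)
      + (2 * (p : ℝ) + 5) / (4 * (2 * p + 4))
      + (2 ^ (2 * p + 2) / ((2 * (p : ℝ) + 4) * ((2 * p + 4).choose (p + 2) : ℝ))
        - 1 / (2 * (2 * (p : ℝ) + 3)) - 1 / (4 * (2 * (p : ℝ) + 4))) := by
  have h0 : ((2 * p + 1).choose p : ℝ) ≠ 0 := by
    exact_mod_cast (Nat.choose_pos (by omega)).ne'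
  have hmid : ((2 * p + 4).choose (p + 2) : ℝ)
      = ((2 * p + 1).choose p : ℝ) * (4 * (2 * p + 3)) / (p + 2) := by
    rw [Nat.choose_succ_succ (2 * p + 3) (p + 1),
      show (2 * p + 3).choose (p + 1).succ = (2 * p + 3).choose (p + 1) from
        Nat.choose_symm_half (p + 1)]
    push_cast
    rw [choose_two_mul_add_three]
    ring
  have hside : ((2 * p + 4).choose (p + 1) : ℝ)
      = ((2 * p + 1).choose p : ℝ) * (4 * (2 * p + 3)) / (p + 3) := by
    have h1 := Nat.choose_mul_succ_eq (2 * p + 3) (p + 1)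
    rw [show 2 * p + 3 + 1 - (p + 1) = p + 3 by omega] at h1
    have h1' : ((2 * p + 3).choose (p + 1) : ℝ) * (2 * p + 4)
        = ((2 * p + 4).choose (p + 1) : ℝ) * (p + 3) := by exact_mod_cast h1
    rw [eq_div_iff (by positivity), ← h1', choose_two_mul_add_three]
    field_simp
    ring
  have hlow : ((2 * p + 2).choose p : ℝ)
      = ((2 * p + 1).choose p : ℝ) * (2 * p + 2) / (p + 2) := by
    have h1 := Nat.choose_mul_succ_eq (2 * p + 1) p
    rw [show 2 * p + 1 + 1 - p = p + 2 by omega] at h1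
    rw [eq_div_iff (by positivity)]
    exact_mod_cast h1.symm
  have hT : chooseRowSum (2 * p + 2) (p + 1)
      = 2 * 4 ^ p - ((2 * p + 1).choose p : ℝ) := by
    have h1 := chooseRowSum_two_mul_add_one p
    rw [chooseRowSum_succ_succ (2 * p + 1) p, h1]
    linear_combination h1 - chooseRowSum_succ (2 * p + 1) p
  have hT' : chooseRowSum (2 * p + 2) p
      = 2 * 4 ^ p - ((2 * p + 1).choose p : ℝ) - ((2 * p + 2).choose p : ℝ) := by
    rw [← hT, chooseRowSum_succ]
    ring
  rw [S_add_two (2 * p + 2) p (by omega), show 2 * p + 2 + 2 = 2 * p + 4 by ring,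
    hT', hT, hlow, hside, hmid, show (2 : ℝ) ^ (2 * p + 2) = 4 * 4 ^ p by
      rw [pow_add, pow_mul]; norm_num; ring]
  push_cast
  field_simp
  ring

/-- The recurrence for `S_n`: for `n ≥ 2`,
`S_n = ((n+1)/(n−1))·S_{n−2} + (n+1)/(4n)
       + [n even]·( 2^{n−2}/(n·C(n,n/2)) − 1/(2(n−1)) − 1/(4n) )`. -/
theorem S_recurrence (n : ℕ) (hn : 2 ≤ n) :
    S n = (((n : ℝ) + 1) / ((n : ℝ) - 1)) * S (n - 2) + ((n : ℝ) + 1) / (4 * (n : ℝ))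
      + (if Even n then
          (2 : ℝ) ^ (n - 2) / ((n : ℝ) * (n.choose (n / 2) : ℝ))
            - 1 / (2 * ((n : ℝ) - 1)) - 1 / (4 * (n : ℝ))
        else 0) := by
  obtain ⟨m, rfl | rfl⟩ := Nat.even_or_odd' n
  · rw [if_pos (even_two_mul m)]
    obtain rfl | ⟨p, rfl⟩ : m = 1 ∨ ∃ p, m = p + 2 := by
      rcases m with _ | _ | p
      · omega
      · simp
      · exact Or.inr ⟨p, rfl⟩
    · norm_num [S, Nat.choose]
    · have h := S_two_mul_add_four p
      rw [show 2 * (p + 2) - 2 = 2 * p + 2 by omega, show 2 * (p + 2) / 2 = p + 2 by omega,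
        show 2 * (p + 2) = 2 * p + 4 by ring, h]
      push_cast
      ring_nf
  · rw [if_neg (by simp)]
    obtain ⟨p, rfl⟩ : ∃ p, m = p + 1 := ⟨m - 1, by omega⟩
    rw [show 2 * (p + 1) + 1 - 2 = 2 * p + 1 by omega,
      show 2 * (p + 1) + 1 = 2 * p + 3 by ring, S_two_mul_add_three p]
    push_cast
    ring_nf
end

section
/- For all integers r ≥ 1 and n ≥ 0, Σ_{ℓ=r−1}^{⌈n/2⌉−1} (ℓ! · (n − 2ℓ + r − 1)) / (ℓ − r + 1)! = r! · C(⌈n/2⌉, r) · ( 2⌈n/2⌉/(r(r+1)) + (r−1)/(r+1) + [n even]/r ), where an empty sum is 0. -/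
theorem Nat.cast_descFactorial_succ_eq_mul (m k : ℕ) :
    (m.descFactorial (k + 1) : ℝ) = ((m : ℝ) - k) * m.descFactorial k := by
  rw [Nat.descFactorial_succ]
  rcases le_or_gt k m with h | h
  · push_cast [h]
    ring
  · simp [Nat.descFactorial_of_lt h]

theorem sum_range_descFactorial_mul_affine (k m : ℕ) (x : ℝ) :
    ∑ ℓ ∈ Finset.range m, (ℓ.descFactorial k : ℝ) * (x - 2 * ℓ + k)
      = m.descFactorial (k + 1) * ((x - k) / (k + 1) - 2 * (m - (k + 1)) / (k + 2)) := by
  have h₁ : (k : ℝ) + 1 ≠ 0 := by positivity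
  have h₂ : (k : ℝ) + 2 ≠ 0 := by positivity
  induction m with
  | zero => simp
  | succ m ih =>
    rw [Finset.sum_range_succ, ih, Nat.succ_descFactorial_succ,
      Nat.cast_descFactorial_succ_eq_mul]
    push_cast
    field_simp
    ring

theorem sum_Ico_factorial_div_factorial_mul (k m : ℕ) (f : ℕ → ℝ) :
    ∑ ℓ ∈ Finset.Ico k m, (ℓ.factorial : ℝ) * f ℓ / ((ℓ - k).factorial : ℝ)
      = ∑ ℓ ∈ Finset.range m, (ℓ.descFactorial k : ℝ) * f ℓ := by
  rw [Finset.range_eq_Ico]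
  refine Finset.sum_subset_zero_on_sdiff (Finset.Ico_subset_Ico_left k.zero_le) ?_ ?_
  · intro ℓ hℓ
    have : ℓ < k := by
      simp only [Finset.mem_sdiff, Finset.mem_Ico] at hℓ
      omega
    simp [Nat.descFactorial_of_lt this]
  · intro ℓ hℓ
    rw [← Nat.factorial_mul_descFactorial (Finset.mem_Ico.mp hℓ).1]
    have : ((ℓ - k).factorial : ℝ) ≠ 0 := by positivity
    push_cast
    field_simp

/-- For all integers `r ≥ 1` and `n ≥ 0`,
`Σ_{ℓ=r−1}^{⌈n/2⌉−1} ℓ!·(n−2ℓ+r−1)/(ℓ−r+1)!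
 = r!·C(⌈n/2⌉,r)·( 2⌈n/2⌉/(r(r+1)) + (r−1)/(r+1) + [n even]/r )`,
with `⌈n/2⌉ = (n+1)/2` (natural division); an empty sum is `0`. -/
theorem factorial_sum_identity (r n : ℕ) (hr : 1 ≤ r) :
    ∑ ℓ ∈ Finset.Ico (r - 1) ((n + 1) / 2),
      ((Nat.factorial ℓ : ℝ) * ((n : ℝ) - 2 * (ℓ : ℝ) + (r : ℝ) - 1))
        / (Nat.factorial (ℓ + 1 - r) : ℝ)
    = (Nat.factorial r : ℝ) * (((n + 1) / 2).choose r : ℝ) *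
        (2 * (((n + 1) / 2 : ℕ) : ℝ) / ((r : ℝ) * ((r : ℝ) + 1))
          + ((r : ℝ) - 1) / ((r : ℝ) + 1)
          + (if Even n then 1 / (r : ℝ) else 0)) := by
  obtain ⟨k, rfl⟩ : ∃ k, r = k + 1 := ⟨r - 1, by omega⟩
  have h := sum_Ico_factorial_div_factorial_mul k ((n + 1) / 2)
    (fun ℓ => (n : ℝ) - 2 * ℓ + k)
  rw [sum_range_descFactorial_mul_affine, Nat.descFactorial_eq_factorial_mul_choose] at h
  simp only [Nat.add_sub_cancel, Nat.add_sub_add_right, Nat.cast_add_one, ← add_assoc,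
    add_sub_cancel_right]
  rw [h, Nat.cast_mul]
  congr 1
  have h₁ : (k : ℝ) + 1 ≠ 0 := by positivity
  have h₂ : (k : ℝ) + 2 ≠ 0 := by positivity
  have h₃ : (k : ℝ) + 1 + 1 ≠ 0 := by positivity
  rcases Nat.even_or_odd' n with ⟨m, rfl | rfl⟩
  · rw [show (2 * m + 1) / 2 = m by omega, if_pos (even_two_mul m)]
    push_cast
    field_simp
    ring
  · rw [show (2 * m + 1 + 1) / 2 = m + 1 by omega,
      if_neg (Nat.not_even_iff_odd.mpr (odd_two_mul_add_one m))]
    push_cast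
    field_simp
    ring
end

section
/- For all natural numbers N ≥ 1 and c with c ≤ N, the inequalities N^c · (1 − c²/(2N)) ≤ c! · C(N,c) ≤ N^c hold in the real numbers. -/
theorem pow_mul_le_two_mul_descFactorial (N c : ℕ) (hc : c ≤ N) :
    (N : ℝ) ^ c * (2 * N - (c : ℝ) ^ 2) ≤ 2 * N * (N.descFactorial c : ℝ) := by
  induction c with
  | zero => simp
  | succ c ih =>
    have hcN : (c : ℝ) ≤ N := by exact_mod_cast (Nat.le_succ c).trans hc
    have step := mul_le_mul_of_nonneg_left (ih (by omega)) (sub_nonneg.mpr hcN)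
    rw [Nat.descFactorial_succ]
    push_cast [Nat.cast_sub ((Nat.le_succ c).trans hc)]
    have hpos : (0 : ℝ) ≤ (N : ℝ) ^ c * (N + (c : ℝ) ^ 3) := by positivity
    linear_combination step + hpos

/-- For natural numbers `1 ≤ N` and `c ≤ N`:
`N^c·(1 − c²/(2N)) ≤ c!·C(N,c) ≤ N^c` in the real numbers. -/
theorem falling_factorial_bounds (N c : ℕ) (hN : 1 ≤ N) (hc : c ≤ N) :
    (N : ℝ) ^ c * (1 - (c : ℝ) ^ 2 / (2 * (N : ℝ)))
      ≤ (Nat.factorial c : ℝ) * (N.choose c : ℝ) ∧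
    (Nat.factorial c : ℝ) * (N.choose c : ℝ) ≤ (N : ℝ) ^ c := by
  rw [← Nat.cast_mul, ← Nat.descFactorial_eq_factorial_mul_choose]
  refine ⟨?_, by exact_mod_cast Nat.descFactorial_le_pow N c⟩
  have hpos : (0 : ℝ) < 2 * N := by positivity
  rw [one_sub_div hpos.ne', ← mul_div_assoc, div_le_iff₀' hpos]
  exact pow_mul_le_two_mul_descFactorial N c hc
end

section
/- Define P : ℕ → ℝ by P_0 = P_1 = 0 and, for n ≥ 2, P_n = (3/2)n + (1/2)H^odd_n − 19/8 − 3[n odd]/(8n) − [n even]/(8(n−1)); define C : ℕ → ℝ by C_0 = C_1 = 0 and, for n ≥ 2, C_n = P_n + (3/C(n,2)) Σ_{k=1}^{n−2} (n−1−k)·C_k. Then for every integer n ≥ 4, C_n = (9/5)n·H_n − (1/5)n·H^alt_n − (89/25)n + (67/40)H_n − (3/40)H^alt_n − 83/800 + (−1)^n/10 − ([n even]/320)(1/(n−3) + 3/(n−1)) + ([n odd]/320)(3/(n−2) + 1/n). -/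
/-- The harmonic number `H_n = Σ_{m=1}^{n} 1/m`. -/
noncomputable def H (n : ℕ) : ℝ := ∑ m ∈ Finset.Icc 1 n, (1 : ℝ) / m

/-- The odd harmonic number `H^odd_n = Σ_{m=1}^{n} [m odd]/m`. -/
noncomputable def Hodd (n : ℕ) : ℝ :=
  ∑ m ∈ Finset.Icc 1 n, if Odd m then (1 : ℝ) / m else 0

/-- The alternating harmonic number `H^alt_n = Σ_{m=1}^{n} (−1)^m/m`. -/
noncomputable def Halt (n : ℕ) : ℝ := ∑ m ∈ Finset.Icc 1 n, (-1 : ℝ) ^ m / m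

theorem H_succ (n : ℕ) : H (n + 1) = H n + 1 / ((n : ℝ) + 1) := by
  simp [H, Finset.sum_Icc_succ_top]

theorem Halt_succ (n : ℕ) : Halt (n + 1) = Halt n + (-1 : ℝ) ^ (n + 1) / ((n : ℝ) + 1) := by
  simp [Halt, Finset.sum_Icc_succ_top]

theorem Hodd_eq (n : ℕ) : Hodd n = (H n - Halt n) / 2 := by
  simp only [Hodd, H, Halt, ← Finset.sum_sub_distrib, Finset.sum_div]
  refine Finset.sum_congr rfl fun m _ => ?_
  rcases Nat.even_or_odd m with hm | hm
  · simp [hm.neg_one_pow, Nat.not_odd_iff_even.mpr hm]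
  · simp [hm.neg_one_pow, hm]
    ring

/-- The second difference of the convolution of a sequence with the identity. -/
theorem sum_mul_second_difference (f : ℕ → ℝ) (j : ℕ) :
    ∑ k ∈ Finset.Icc 1 (j + 2), ((j : ℝ) + 3 - k) * f k
      - 2 * ∑ k ∈ Finset.Icc 1 (j + 1), ((j : ℝ) + 2 - k) * f k
      + ∑ k ∈ Finset.Icc 1 j, ((j : ℝ) + 1 - k) * f k = f (j + 2) := by
  have hsum : ∑ k ∈ Finset.Icc 1 j, ((j : ℝ) + 3 - k) * f k
      - 2 * ∑ k ∈ Finset.Icc 1 j, ((j : ℝ) + 2 - k) * f k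
      + ∑ k ∈ Finset.Icc 1 j, ((j : ℝ) + 1 - k) * f k = 0 := by
    rw [Finset.mul_sum, ← Finset.sum_sub_distrib, ← Finset.sum_add_distrib]
    exact Finset.sum_eq_zero fun k _ => by ring
  rw [Finset.sum_Icc_succ_top (by omega), Finset.sum_Icc_succ_top (by omega),
    Finset.sum_Icc_succ_top (by omega)]
  push_cast
  linear_combination hsum

/-- The dual-pivot quicksort recurrence with its sum eliminated by taking second differences. -/
theorem dualPivot_second_difference (P C : ℕ → ℝ)
    (hC : ∀ n : ℕ, 2 ≤ n →
      C n = P n + (3 / (n.choose 2 : ℝ)) *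
        ∑ k ∈ Finset.Icc 1 (n - 2), ((n : ℝ) - 1 - (k : ℝ)) * C k)
    (n : ℕ) (hn : 2 ≤ n) :
    (C (n + 2) - P (n + 2)) * (((n : ℝ) + 2) * (n + 1))
      - 2 * ((C (n + 1) - P (n + 1)) * (((n : ℝ) + 1) * n))
      + (C n - P n) * ((n : ℝ) * (n - 1)) = 6 * C n := by
  have hT (j : ℕ) : (C (j + 2) - P (j + 2)) * (((j : ℝ) + 2) * (j + 1))
      = 6 * ∑ k ∈ Finset.Icc 1 j, ((j : ℝ) + 1 - k) * C k := by
    rw [hC (j + 2) (by omega), Nat.cast_choose_two, Nat.add_sub_cancel]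
    have hsum : ∑ k ∈ Finset.Icc 1 j, (((j + 2 : ℕ) : ℝ) - 1 - k) * C k
        = ∑ k ∈ Finset.Icc 1 j, ((j : ℝ) + 1 - k) * C k :=
      Finset.sum_congr rfl fun k _ => by push_cast; ring
    rw [hsum]
    have h1 : (j : ℝ) + 1 ≠ 0 := by positivity
    have h2 : (j : ℝ) + 2 ≠ 0 := by positivity
    push_cast
    rw [show (j : ℝ) + 2 - 1 = j + 1 by ring]
    field_simp
    ring
  obtain ⟨j, rfl⟩ := Nat.exists_eq_add_of_le' hn
  have h0 := hT j
  have h1 := hT (j + 1)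
  have h2 := hT (j + 2)
  have hd := sum_mul_second_difference C j
  push_cast at h1 h2 ⊢
  simp only [show (j : ℝ) + 1 + 1 = j + 2 by ring, show (j : ℝ) + 2 + 1 = j + 3 by ring] at h1 h2
  rw [show j + 1 + 2 = j + 2 + 1 by ring] at h1
  linear_combination h2 - 2 * h1 + h0 + 6 * hd

/-- The exact expected comparison count of dual-pivot quicksort with strategy "Count":
if `P` is the expected partitioning cost of "Count" and `C` satisfies the dual-pivot
quicksort recurrence, then for every `n ≥ 4` the displayed exact formula holds. -/
theorem count_quicksort_exact_cost (P C : ℕ → ℝ)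
    (hP0 : P 0 = 0) (hP1 : P 1 = 0)
    (hP : ∀ n : ℕ, 2 ≤ n →
      P n = (3 / 2) * (n : ℝ) + (1 / 2) * Hodd n - 19 / 8
        - (if Odd n then 3 / (8 * (n : ℝ)) else 0)
        - (if Even n then 1 / (8 * ((n : ℝ) - 1)) else 0))
    (hC0 : C 0 = 0) (hC1 : C 1 = 0)
    (hC : ∀ n : ℕ, 2 ≤ n →
      C n = P n + (3 / (n.choose 2 : ℝ)) *
        ∑ k ∈ Finset.Icc 1 (n - 2), ((n : ℝ) - 1 - (k : ℝ)) * C k) :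
    ∀ n : ℕ, 4 ≤ n →
      C n = (9 / 5) * (n : ℝ) * H n - (1 / 5) * (n : ℝ) * Halt n - (89 / 25) * (n : ℝ)
        + (67 / 40) * H n - (3 / 40) * Halt n - 83 / 800 + (-1 : ℝ) ^ n / 10
        - (if Even n then (1 : ℝ) / 320 else 0) * (1 / ((n : ℝ) - 3) + 3 / ((n : ℝ) - 1))
        + (if Odd n then (1 : ℝ) / 320 else 0) * (3 / ((n : ℝ) - 2) + 1 / (n : ℝ)) := by
  intro n hn
  induction n using Nat.strong_induction_on with
  | _ n ih =>
    have hC2 : C 2 = 1 := by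
      rw [hC 2 le_rfl, hP 2 le_rfl]
      norm_num [Hodd, Finset.sum_Icc_succ_top, Nat.odd_iff, Nat.even_iff]
    have hC3 : C 3 = 8 / 3 := by
      rw [hC 3 (by norm_num), hP 3 (by norm_num)]
      norm_num [Hodd, Finset.sum_Icc_succ_top, Nat.odd_iff, Nat.even_iff, Nat.choose, hC1]
    obtain rfl | rfl | hn6 : n = 4 ∨ n = 5 ∨ 6 ≤ n := by omega
    · rw [hC 4 (by norm_num), hP 4 (by norm_num)]
      norm_num [Hodd, H, Halt, Finset.sum_Icc_succ_top, Nat.odd_iff, Nat.even_iff, Nat.choose,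
        hC1, hC2]
    · rw [hC 5 (by norm_num), hP 5 (by norm_num)]
      norm_num [Hodd, H, Halt, Finset.sum_Icc_succ_top, Nat.odd_iff, Nat.even_iff, Nat.choose,
        hC1, hC2, hC3]
    obtain ⟨m, rfl⟩ : ∃ m, n = m + 2 := ⟨n - 2, by omega⟩
    have hrec := dualPivot_second_difference P C hC m (by omega)
    rw [hP m (by omega), hP (m + 1) (by omega), hP (m + 2) (by omega), ih m (by omega) (by omega),
      ih (m + 1) (by omega) (by omega)] at hrec
    have hm : (4 : ℝ) ≤ m := by exact_mod_cast (show 4 ≤ m by omega)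
    have hm0 : (m : ℝ) ≠ 0 := by linarith
    have hm1 : (m : ℝ) + 1 ≠ 0 := by linarith
    have hm2 : (m : ℝ) + 2 ≠ 0 := by linarith
    have hs1 : (m : ℝ) - 1 ≠ 0 := by linarith
    have hs2 : (m : ℝ) - 2 ≠ 0 := by linarith
    have hs3 : (m : ℝ) - 3 ≠ 0 := by linarith
    refine mul_right_cancel₀ (mul_ne_zero hm2 hm1) ?_
    simp only [Hodd_eq, Halt_succ, H_succ, pow_succ] at hrec ⊢
    rcases Nat.even_or_odd m with he | ho
    · simp only [he, he.neg_one_pow, Nat.even_add_one, Nat.odd_add_one, Nat.not_odd_iff_even.mpr he,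
        not_true_eq_false, not_false_eq_true, if_true, if_false] at hrec ⊢
      push_cast at hrec ⊢
      refine sub_eq_zero.mp (Eq.trans ?_ (sub_eq_zero.mpr hrec))
      simp only [show (m : ℝ) + 1 + 1 = m + 2 by ring, show (m : ℝ) + 2 - 3 = m - 1 by ring,
        show (m : ℝ) + 2 - 1 = m + 1 by ring, show (m : ℝ) + 1 - 2 = m - 1 by ring]
      field_simp
      ring
    · simp only [ho, ho.neg_one_pow, Nat.even_add_one, Nat.odd_add_one, Nat.not_even_iff_odd.mpr ho,
        not_true_eq_false, not_false_eq_true, if_true, if_false] at hrec ⊢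
      push_cast at hrec ⊢
      refine sub_eq_zero.mp (Eq.trans ?_ (sub_eq_zero.mpr hrec))
      simp only [show (m : ℝ) + 1 + 1 = m + 2 by ring, show (m : ℝ) + 2 - 2 = m by ring,
        show (m : ℝ) + 1 - 3 = m - 2 by ring, show (m : ℝ) + 1 - 1 = m by ring]
      field_simp
      ring
end

section
/- Define P : ℕ → ℝ by P_0 = P_1 = 0 and, for n ≥ 2, P_n = (3/2)n + (1/2)H^odd_n − 19/8 − 3[n odd]/(8n) − [n even]/(8(n−1)); define C : ℕ → ℝ by C_0 = C_1 = 0 and, for n ≥ 2, C_n = P_n + (3/C(n,2)) Σ_{k=1}^{n−2} (n−1−k)·C_k. Then for every n ∈ ℕ, C_n ≤ 2(n+1)H_n − 4n, the expected comparison count of classical single-pivot quicksort. -/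
theorem Hodd_succ (n : ℕ) :
    Hodd (n + 1) = Hodd n + if Odd (n + 1) then 1 / ((n : ℝ) + 1) else 0 := by
  simp [Hodd, Finset.sum_Icc_succ_top]

/-- The expected number of key comparisons of classical single-pivot quicksort. -/
noncomputable def classicalCost (n : ℕ) : ℝ := 2 * ((n : ℝ) + 1) * H n - 4 * (n : ℝ)

theorem sum_classicalCost (m : ℕ) :
    ∑ k ∈ Finset.Icc 1 m, classicalCost k =
      ((m : ℝ) + 1) * (classicalCost (m + 1) - m) / 2 := by
  induction m with
  | zero => norm_num [classicalCost, H]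
  | succ m ih =>
    rw [Finset.sum_Icc_succ_top (by omega), ih]
    simp only [classicalCost, H_succ]
    push_cast
    field_simp
    ring

/-- The classical cost satisfies the dual-pivot recurrence with partitioning cost
`(5 n - 7) / 3`. -/
theorem sum_mul_classicalCost (m : ℕ) :
    ∑ k ∈ Finset.Icc 1 m, ((m : ℝ) + 1 - k) * classicalCost k =
      ((m : ℝ) + 2) * (m + 1) / 6 * (classicalCost (m + 2) - (5 * (m : ℝ) + 3) / 3) := by
  induction m with
  | zero => norm_num [classicalCost, H, Finset.sum_Icc_succ_top]
  | succ m ih =>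
    have h : ∑ k ∈ Finset.Icc 1 (m + 1), (((m + 1 : ℕ) : ℝ) + 1 - k) * classicalCost k =
        ∑ k ∈ Finset.Icc 1 m, ((m : ℝ) + 1 - k) * classicalCost k +
          ∑ k ∈ Finset.Icc 1 (m + 1), classicalCost k := by
      simp only [Finset.sum_Icc_succ_top (Nat.le_add_left 1 m)]
      rw [← add_assoc, ← Finset.sum_add_distrib]
      congr 1
      · refine Finset.sum_congr rfl fun k _ => ?_
        push_cast
        ring
      · push_cast
        ring
    rw [h, ih, sum_classicalCost]
    simp only [classicalCost, H_succ]
    push_cast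
    field_simp
    ring

theorem Hodd_even_le (m : ℕ) :
    Hodd (2 * m + 2) ≤ 2 * ((m : ℝ) + 1) / 3 + 1 / 12 + 1 / (4 * (2 * (m : ℝ) + 1)) := by
  induction m with
  | zero => norm_num [Hodd, Finset.sum_Icc_succ_top]
  | succ m ih =>
    have e : Hodd (2 * (m + 1) + 2) = Hodd (2 * m + 2) + 1 / (2 * (m : ℝ) + 3) := by
      have h1 : Odd (2 * m + 2 + 1) := ⟨m + 1, by ring⟩
      have h2 : ¬ Odd (2 * m + 2 + 1 + 1) := by simp [Nat.odd_add_one, h1]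
      rw [show 2 * (m + 1) + 2 = 2 * m + 2 + 1 + 1 by ring, Hodd_succ, Hodd_succ, if_pos h1,
        if_neg h2]
      push_cast
      ring
    rw [e]
    have hm : (0 : ℝ) ≤ m := m.cast_nonneg
    have key : 1 / (2 * (m : ℝ) + 3) + 1 / (4 * (2 * (m : ℝ) + 1)) ≤
        2 / 3 + 1 / (4 * (2 * (m : ℝ) + 3)) := by
      rw [div_add_div _ _ (by positivity) (by positivity),
        div_add_div _ _ (by positivity) (by positivity),
        div_le_div_iff₀ (by positivity) (by positivity), ← sub_nonneg]
      ring_nf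
      positivity
    push_cast
    rw [show 2 * ((m : ℝ) + 1) + 1 = 2 * (m : ℝ) + 3 by ring]
    linarith

theorem Hodd_odd_le (m : ℕ) :
    Hodd (2 * m + 3) ≤ (2 * (m : ℝ) + 3) / 3 + 1 / 12 + 3 / (4 * (2 * (m : ℝ) + 3)) := by
  have h1 : Odd (2 * m + 2 + 1) := ⟨m + 1, by ring⟩
  rw [show 2 * m + 3 = 2 * m + 2 + 1 by ring, Hodd_succ, if_pos h1]
  have hm : (0 : ℝ) ≤ m := m.cast_nonneg
  have key : 1 / (2 * (m : ℝ) + 3) + 1 / (4 * (2 * (m : ℝ) + 1)) ≤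
      1 / 3 + 3 / (4 * (2 * (m : ℝ) + 3)) := by
    rw [div_add_div _ _ (by positivity) (by positivity),
      div_add_div _ _ (by positivity) (by positivity),
      div_le_div_iff₀ (by positivity) (by positivity), ← sub_nonneg]
    ring_nf
    positivity
  have := Hodd_even_le m
  push_cast
  rw [show 2 * (m : ℝ) + 2 + 1 = 2 * (m : ℝ) + 3 by ring]
  linarith

/-- The partitioning cost of "Count" on `n + 2` elements is at most `(5 (n + 2) - 7) / 3`. -/
theorem count_partitioning_le (n : ℕ) :
    (3 / 2) * ((n + 2 : ℕ) : ℝ) + (1 / 2) * Hodd (n + 2) - 19 / 8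
        - (if Odd (n + 2) then 3 / (8 * ((n + 2 : ℕ) : ℝ)) else 0)
        - (if Even (n + 2) then 1 / (8 * (((n + 2 : ℕ) : ℝ) - 1)) else 0) ≤
      (5 * (n : ℝ) + 3) / 3 := by
  rcases Nat.even_or_odd' n with ⟨m, rfl | rfl⟩
  · have he : Even (2 * m + 2) := ⟨m + 1, by ring⟩
    have h := Hodd_even_le m
    have e : 1 / (4 * (2 * (m : ℝ) + 1)) = 2 * (1 / (8 * (2 * (m : ℝ) + 1))) := by
      field_simp
      norm_num
    rw [if_neg (Nat.not_odd_iff_even.mpr he), if_pos he]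
    push_cast
    rw [show 2 * (m : ℝ) + 2 - 1 = 2 * (m : ℝ) + 1 by ring]
    linarith
  · have ho : Odd (2 * m + 1 + 2) := ⟨m + 1, by ring⟩
    have h := Hodd_odd_le m
    have e : 3 / (4 * (2 * (m : ℝ) + 3)) = 2 * (3 / (8 * (2 * (m : ℝ) + 3))) := by
      field_simp
      norm_num
    rw [if_pos ho, if_neg (Nat.not_even_iff_odd.mpr ho)]
    push_cast
    rw [show 2 * (m : ℝ) + 1 + 2 = 2 * (m : ℝ) + 3 by ring]
    linarith

/-- Dual-pivot quicksort with strategy "Count" never uses more comparisons on average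
than classical single-pivot quicksort: if `P` is the expected partitioning cost of
"Count" and `C` satisfies the dual-pivot quicksort recurrence, then for every `n`,
`C_n ≤ 2(n+1)H_n − 4n`. -/
theorem count_quicksort_beats_classical (P C : ℕ → ℝ)
    (hP0 : P 0 = 0) (hP1 : P 1 = 0)
    (hP : ∀ n : ℕ, 2 ≤ n →
      P n = (3 / 2) * (n : ℝ) + (1 / 2) * Hodd n - 19 / 8
        - (if Odd n then 3 / (8 * (n : ℝ)) else 0)
        - (if Even n then 1 / (8 * ((n : ℝ) - 1)) else 0))
    (hC0 : C 0 = 0) (hC1 : C 1 = 0)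
    (hC : ∀ n : ℕ, 2 ≤ n →
      C n = P n + (3 / (n.choose 2 : ℝ)) *
        ∑ k ∈ Finset.Icc 1 (n - 2), ((n : ℝ) - 1 - (k : ℝ)) * C k) :
    ∀ n : ℕ, C n ≤ 2 * ((n : ℝ) + 1) * H n - 4 * (n : ℝ) := by
  intro n
  change C n ≤ classicalCost n
  induction n using Nat.strong_induction_on with
  | _ n ih =>
    match n, ih with
    | 0, _ => simp [hC0, classicalCost, H]
    | 1, _ => norm_num [hC1, classicalCost, H]
    | m + 2, ih =>
      have hsum : ∑ k ∈ Finset.Icc 1 m, ((m : ℝ) + 1 - k) * C k ≤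
          ∑ k ∈ Finset.Icc 1 m, ((m : ℝ) + 1 - k) * classicalCost k := by
        refine Finset.sum_le_sum fun k hk => ?_
        have hkm := (Finset.mem_Icc.mp hk).2
        have hkm' : (k : ℝ) ≤ m := by exact_mod_cast hkm
        exact mul_le_mul_of_nonneg_left (ih k (by omega)) (by linarith)
      have hchoose : (((m + 2).choose 2 : ℕ) : ℝ) = ((m : ℝ) + 2) * (m + 1) / 2 := by
        rw [Nat.cast_choose_two]
        push_cast
        ring
      have hp := count_partitioning_le m
      rw [← hP (m + 2) (by omega)] at hp
      rw [hC (m + 2) (by omega), hchoose, Nat.add_sub_cancel]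
      have hcoef : ((m + 2 : ℕ) : ℝ) - 1 = (m : ℝ) + 1 := by
        push_cast
        ring
      rw [hcoef]
      rw [sum_mul_classicalCost] at hsum
      calc _ ≤ (5 * (m : ℝ) + 3) / 3 + 3 / (((m : ℝ) + 2) * (m + 1) / 2) *
            (((m : ℝ) + 2) * (m + 1) / 6 *
              (classicalCost (m + 2) - (5 * (m : ℝ) + 3) / 3)) := by
            gcongr
        _ = classicalCost (m + 2) := by
            field_simp
            ring
end
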